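/- arXiv:1611.01403 — 5 statements merged into one kernel-verified Lean document; each statement's English description precedes it below -/
import Mathlib

section
/- Let Δ ≥ 2 be a real number, let 0 < c < 1/64, and let q be a real number with 0 ≤ q < c/√Δ. Then for all integers ℓ ≥ 1 and 0 ≤ h ≤ ℓ, the sum ∑_{j=0}^{⌊(ℓ−h)/2⌋} C(ℓ, j) · C(ℓ − j, ℓ − h − 2j) · q^{ℓ−h−2j} · (q/Δ)^j is at most (4√Δ)^h · Δ^{−ℓ/2}. -/
/-- Summing `C(ℓ, j) C(ℓ - j, k j)` over distinct `j ≤ ℓ` counts at most `3 ^ ℓ` configurations. -/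
theorem sum_choose_mul_choose_sub_le_three_pow (ℓ m : ℕ) (hm : m ≤ ℓ + 1) (k : ℕ → ℕ) :
    ∑ j ∈ Finset.range m, ℓ.choose j * (ℓ - j).choose (k j) ≤ 3 ^ ℓ := by
  calc ∑ j ∈ Finset.range m, ℓ.choose j * (ℓ - j).choose (k j)
      ≤ ∑ j ∈ Finset.range (ℓ + 1), ℓ.choose j * (ℓ - j).choose (k j) :=
        Finset.sum_le_sum_of_subset (Finset.range_mono hm)
    _ ≤ ∑ j ∈ Finset.range (ℓ + 1), ℓ.choose j * 2 ^ (ℓ - j) :=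
        Finset.sum_le_sum fun j _ => Nat.mul_le_mul_left _ (Nat.choose_le_two_pow _ _)
    _ = (1 + 2) ^ ℓ := by
        rw [add_pow]
        exact Finset.sum_congr rfl fun j _ => by simp [mul_comm]
    _ = 3 ^ ℓ := by norm_num


/-- Deterministic counting bound: if `0 ≤ q < c/√Δ` with `0 < c < 1/64` and `Δ ≥ 2`, then for
all integers `1 ≤ ℓ` and `0 ≤ h ≤ ℓ`,
`∑_{j=0}^{⌊(ℓ-h)/2⌋} C(ℓ,j) C(ℓ-j, ℓ-h-2j) q^{ℓ-h-2j} (q/Δ)^j ≤ (4√Δ)^h Δ^{-ℓ/2}`. -/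
theorem stmt_3
    (Δ : ℝ) (hΔ : 2 ≤ Δ) (c : ℝ) (hc0 : 0 < c) (hc1 : c < 1/64)
    (q : ℝ) (hq0 : 0 ≤ q) (hq : q < c / Real.sqrt Δ)
    (ℓ h : ℕ) (hℓ : 1 ≤ ℓ) (hh : h ≤ ℓ) :
    ∑ j ∈ Finset.range ((ℓ - h) / 2 + 1),
        (Nat.choose ℓ j : ℝ) * (Nat.choose (ℓ - j) (ℓ - h - 2 * j) : ℝ) *
          q ^ (ℓ - h - 2 * j) * (q / Δ) ^ j
      ≤ (4 * Real.sqrt Δ) ^ h * Δ ^ (-((ℓ : ℝ) / 2)) := by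
  set s := Real.sqrt Δ with hs
  have hs1 : 1 ≤ s := Real.one_le_sqrt.mpr (by linarith)
  have hs0 : 0 < s := by linarith
  have hsq : s ^ 2 = Δ := Real.sq_sqrt (by linarith)
  have hqs : q * s < 1 / 64 := ((lt_div_iff₀ hs0).mp hq).trans hc1
  have hq_le : q ≤ 1 / (8 * s) := by
    rw [le_div_iff₀ (by positivity)]
    linarith
  have hqΔ_le : q / Δ ≤ (1 / (8 * s)) ^ 2 := by
    rw [← hsq, div_pow, div_le_div_iff₀ (by positivity) (by positivity)]
    nlinarith [mul_le_mul_of_nonneg_left hs1 hq0, sq_nonneg s]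
  have hrpow : Δ ^ (-((ℓ : ℝ) / 2)) = (s ^ ℓ)⁻¹ := by
    rw [Real.rpow_neg (by linarith), Real.rpow_div_two_eq_sqrt _ (by linarith),
      Real.rpow_natCast]
  have hterm : ∀ j ∈ Finset.range ((ℓ - h) / 2 + 1),
      (Nat.choose ℓ j : ℝ) * (Nat.choose (ℓ - j) (ℓ - h - 2 * j) : ℝ) *
          q ^ (ℓ - h - 2 * j) * (q / Δ) ^ j
        ≤ (Nat.choose ℓ j : ℝ) * (Nat.choose (ℓ - j) (ℓ - h - 2 * j) : ℝ) *
          (1 / (8 * s)) ^ (ℓ - h) := by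
    intro j hj
    have hj2 : ℓ - h - 2 * j + 2 * j = ℓ - h := by
      rw [Finset.mem_range] at hj
      omega
    rw [mul_assoc _ (q ^ _)]
    refine mul_le_mul_of_nonneg_left ?_ (by positivity)
    calc q ^ (ℓ - h - 2 * j) * (q / Δ) ^ j
        ≤ (1 / (8 * s)) ^ (ℓ - h - 2 * j) * ((1 / (8 * s)) ^ 2) ^ j := by gcongr
      _ = (1 / (8 * s)) ^ (ℓ - h) := by rw [← pow_mul, ← pow_add, hj2]
  have hcount : ∑ j ∈ Finset.range ((ℓ - h) / 2 + 1),
      (Nat.choose ℓ j : ℝ) * (Nat.choose (ℓ - j) (ℓ - h - 2 * j) : ℝ) ≤ 3 ^ ℓ := by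
    exact_mod_cast sum_choose_mul_choose_sub_le_three_pow ℓ _ (by omega) fun j => ℓ - h - 2 * j
  refine (Finset.sum_le_sum hterm).trans ?_
  rw [← Finset.sum_mul, hrpow]
  refine (mul_le_mul_of_nonneg_right hcount (by positivity)).trans ?_
  obtain ⟨n, rfl⟩ := Nat.exists_eq_add_of_le hh
  rw [Nat.add_sub_cancel_left]
  calc (3 : ℝ) ^ (h + n) * (1 / (8 * s)) ^ n
      = 3 ^ h * (3 / 8) ^ n * (s ^ n)⁻¹ := by
        rw [pow_add, div_pow, div_pow, mul_pow, one_pow]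
        field_simp
    _ ≤ 4 ^ h * 1 * (s ^ n)⁻¹ := by
        gcongr
        · norm_num
        · exact pow_le_one₀ (by norm_num) (by norm_num)
    _ = (4 * s) ^ h * (s ^ (h + n))⁻¹ := by
        rw [mul_pow, pow_add]
        field_simp
end

section
/- Let T be a finite tree (connected acyclic simple graph) with a designated root σ, and for each vertex v let d(v) be the graph distance from σ to v, let Δ_v be the degree of v, and let β(v) be the product of the degrees Δ_w over all vertices w on the unique path from σ to v excluding v itself (so β(σ) = 1). Then for every real number 0 < c < 1, ∑_{v ∈ T} c^{d(v)} / β(v) ≤ 1/(1−c). -/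
/-- A vertex at distance `n + 1` from the root of a connected graph has a neighbour `u` at
distance `n`, and any function computed along paths as the product of the degrees picks up the
factor `G.degree u` in passing from `u` to `v`. -/
theorem exists_adj_dist_eq_and_eq_mul_degree
    {V : Type*} [Fintype V] [DecidableEq V]
    {G : SimpleGraph V} [DecidableRel G.Adj] (hG : G.Connected) {σ : V} {β : V → ℝ}
    (hβ : ∀ (v : V) (p : G.Walk σ v), p.IsPath →
      β v = ∏ w ∈ p.support.toFinset.erase v, (G.degree w : ℝ))
    {n : ℕ} {v : V} (hv : G.dist σ v = n + 1) :
    ∃ u, G.Adj u v ∧ G.dist σ u = n ∧ β v = β u * G.degree u := by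
  obtain ⟨p, hp⟩ := hG.exists_walk_length_eq_dist v σ
  have hpath := p.isPath_of_length_eq_dist hp
  rw [G.dist_comm, hv] at hp
  cases p with
  | nil => simp at hp
  | @cons _ u _ h q =>
    have hq : q.IsPath ∧ v ∉ q.support := by simpa using hpath
    refine ⟨u, h.symm, ?_, ?_⟩
    · have h1 := SimpleGraph.dist_le q
      have h2 := hG.dist_triangle (u := σ) (v := u) (w := v)
      rw [SimpleGraph.dist_eq_one_iff_adj.2 h.symm] at h2
      rw [G.dist_comm] at h1
      simp only [SimpleGraph.Walk.length_cons] at hp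
      omega
    · rw [hβ v _ hpath.reverse, hβ u _ hq.1.reverse]
      simp only [SimpleGraph.Walk.support_reverse, List.toFinset_reverse,
        SimpleGraph.Walk.support_cons, List.toFinset_cons]
      rw [Finset.erase_insert (by simpa using hq.2), Finset.prod_erase_mul _ _ (by simp)]

/-- The reciprocals of the degree products `β` over each sphere around the root sum to at
most `1`. -/
theorem sum_inv_filter_dist_le_one
    {V : Type*} [Fintype V] [DecidableEq V]
    {G : SimpleGraph V} [DecidableRel G.Adj] (hG : G.Connected) {σ : V} {β : V → ℝ}
    (hβ : ∀ (v : V) (p : G.Walk σ v), p.IsPath →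
      β v = ∏ w ∈ p.support.toFinset.erase v, (G.degree w : ℝ))
    (n : ℕ) : ∑ v with G.dist σ v = n, (β v)⁻¹ ≤ 1 := by
  have hnonneg (v : V) : 0 ≤ β v := by
    obtain ⟨p, hp⟩ := hG.exists_isPath σ v
    rw [hβ v p hp]
    positivity
  induction n with
  | zero =>
    have hσ : β σ = 1 := by simp [hβ σ .nil .nil]
    have hs : ({v | G.dist σ v = 0} : Finset V) = {σ} := by
      ext v
      simp [hG.dist_eq_zero_iff, eq_comm]
    rw [hs, Finset.sum_singleton, hσ, inv_one]
  | succ n ih =>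
    refine le_trans ?_ ih
    calc ∑ v with G.dist σ v = n + 1, (β v)⁻¹
        ≤ ∑ v with G.dist σ v = n + 1, ∑ u with G.dist σ u = n,
            if G.Adj u v then (β u * G.degree u)⁻¹ else 0 := by
          refine Finset.sum_le_sum fun v hv => ?_
          obtain ⟨u, huv, hu, hβu⟩ :=
            exists_adj_dist_eq_and_eq_mul_degree hG hβ (Finset.mem_filter.1 hv).2
          refine le_trans ?_ (Finset.single_le_sum (fun w _ => ?_)
            (Finset.mem_filter.2 ⟨Finset.mem_univ u, hu⟩))
          · simp [huv, hβu]
          · have := hnonneg w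
            positivity
      _ ≤ ∑ v, ∑ u with G.dist σ u = n,
            if G.Adj u v then (β u * G.degree u)⁻¹ else 0 := by
          refine Finset.sum_le_sum_of_subset_of_nonneg (Finset.filter_subset _ _)
            fun v _ _ => Finset.sum_nonneg fun w _ => ?_
          have := hnonneg w
          positivity
      _ = ∑ u with G.dist σ u = n, ∑ v, if G.Adj u v then (β u * G.degree u)⁻¹ else 0 :=
          Finset.sum_comm
      _ ≤ ∑ u with G.dist σ u = n, (β u)⁻¹ := by
          refine Finset.sum_le_sum fun u _ => ?_
          rw [← Finset.sum_filter, Finset.sum_const, nsmul_eq_mul,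
            ← SimpleGraph.neighborFinset_eq_filter, SimpleGraph.card_neighborFinset_eq_degree,
            mul_inv, mul_left_comm]
          exact mul_le_of_le_one_right (inv_nonneg.2 (hnonneg u)) mul_inv_le_one

/-- For a finite rooted tree with root `σ`, where `β v` is the product of degrees along the path
from `σ` to `v` excluding `v`, and `d v` is the distance from the root:
for every `0 < c < 1`, `∑_v c^{d(v)}/β(v) ≤ 1/(1-c)`. -/
theorem stmt_5
    {V : Type*} [Fintype V] [DecidableEq V]
    (G : SimpleGraph V) [DecidableRel G.Adj] (hG : G.IsTree) (σ : V)
    (β : V → ℝ)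
    (hβ : ∀ (v : V) (p : G.Walk σ v), p.IsPath →
      β v = ∏ w ∈ p.support.toFinset.erase v, (G.degree w : ℝ))
    (c : ℝ) (hc0 : 0 < c) (hc1 : c < 1) :
    ∑ v : V, c ^ (G.dist σ v) / β v ≤ 1 / (1 - c) := by
  calc ∑ v, c ^ G.dist σ v / β v
      = ∑ n ∈ Finset.univ.image (G.dist σ), ∑ v with G.dist σ v = n, c ^ G.dist σ v / β v :=
        (Finset.sum_fiberwise_of_maps_to (fun v _ => Finset.mem_image_of_mem _
          (Finset.mem_univ v)) _).symm
    _ ≤ ∑ n ∈ Finset.univ.image (G.dist σ), c ^ n := by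
        refine Finset.sum_le_sum fun n _ => ?_
        calc ∑ v with G.dist σ v = n, c ^ G.dist σ v / β v
            = c ^ n * ∑ v with G.dist σ v = n, (β v)⁻¹ := by
              rw [Finset.mul_sum]
              refine Finset.sum_congr rfl fun v hv => ?_
              rw [(Finset.mem_filter.1 hv).2, div_eq_mul_inv]
          _ ≤ c ^ n := mul_le_of_le_one_right (by positivity)
              (sum_inv_filter_dist_le_one hG.connected hβ n)
    _ ≤ ∑' n, c ^ n := (summable_geometric_of_lt_one hc0.le hc1).sum_le_tsum _
        fun n _ => by positivity
    _ = 1 / (1 - c) := by rw [tsum_geometric_of_lt_one hc0.le hc1, one_div]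
end

section
/- Let T be a finite tree (connected acyclic simple graph) with a designated root σ, and for each vertex v let d(v) be the graph distance from σ to v, let Δ_v be the degree of v, and let β(v) be the product of the degrees Δ_w over all vertices w on the unique path from σ to v excluding v itself (so β(σ) = 1). Then for every real number 0 < c < 1, ∑_{v ∈ T} d(v) · c^{d(v)} / β(v) ≤ c/(1−c)². -/
namespace SimpleGraph

variable {V : Type*} {G : SimpleGraph V}

/-- In a connected graph, every vertex at positive distance from `σ` is the end of a path from `σ`
whose initial part is a shortest path. -/
theorem Connected.exists_isPath_concat_of_dist_eq_succ (hG : G.Connected) {σ v : V} {n : ℕ}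
    (hv : G.dist σ v = n + 1) :
    ∃ (u : V) (q : G.Walk σ u) (h : G.Adj u v),
      G.dist σ u = n ∧ q.IsPath ∧ (q.concat h).IsPath := by
  obtain ⟨p, hp, hlen⟩ := hG.exists_path_of_dist σ v
  have hnil : ¬ p.Nil := by
    rw [← Walk.length_eq_zero_iff]
    omega
  have hpath : (p.dropLast.concat (p.adj_penultimate hnil)).IsPath := by
    rwa [p.concat_dropLast]
  have hl : p.dropLast.length + 1 = p.length := by
    rw [← Walk.length_concat _ (p.adj_penultimate hnil), p.concat_dropLast]
  refine ⟨_, p.dropLast, p.adj_penultimate hnil, ?_, ((Walk.concat_isPath_iff _).1 hpath).1, hpath⟩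
  have h₁ := dist_le p.dropLast
  have h₂ := hG.dist_triangle (u := σ) (v := p.penultimate) (w := v)
  rw [dist_eq_one_iff_adj.2 (p.adj_penultimate hnil)] at h₂
  omega

variable [DecidableEq V]

/-- A product over the vertices of a path, last vertex excluded, picks up the factor of the former
endpoint when the path is extended by an edge. -/
theorem Walk.IsPath.prod_support_concat_erase {M : Type*} [CommMonoid M] (f : V → M) {σ u v : V}
    {q : G.Walk σ u} {h : G.Adj u v} (hq : (q.concat h).IsPath) :
    ∏ w ∈ (q.concat h).support.toFinset.erase v, f w =
      (∏ w ∈ q.support.toFinset.erase u, f w) * f u := by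
  have hv : v ∉ q.support := ((Walk.concat_isPath_iff h).1 hq).2
  have hs : (q.concat h).support.toFinset.erase v = q.support.toFinset := by
    ext w
    simp only [Walk.support_concat, Finset.mem_erase, List.mem_toFinset, List.mem_append,
      List.mem_singleton]
    grind
  rw [hs, Finset.prod_erase_mul _ _ (by simp)]

variable [Fintype V] [DecidableRel G.Adj]

/-- If `β` is the product of the degrees along paths from `σ`, last vertex excluded, then the
values `1 / β v` over a sphere around `σ` sum to at most one. -/
theorem Connected.sum_inv_le_one_of_prod_degree (hG : G.Connected) {σ : V} {β : V → ℝ}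
    (hβ : ∀ (v : V) (p : G.Walk σ v), p.IsPath →
      β v = ∏ w ∈ p.support.toFinset.erase v, (G.degree w : ℝ)) (n : ℕ) :
    ∑ v with G.dist σ v = n, (β v)⁻¹ ≤ 1 := by
  have hβ_nonneg (v : V) : 0 ≤ β v := by
    obtain ⟨p, hp, -⟩ := hG.exists_path_of_dist σ v
    rw [hβ v p hp]
    positivity
  induction n with
  | zero =>
    have hσ : β σ = 1 := by simpa using hβ σ .nil .nil
    have hs : ({v | G.dist σ v = 0} : Finset V) = {σ} := by
      ext v
      simp [hG.dist_eq_zero_iff, eq_comm]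
    rw [hs, Finset.sum_singleton, hσ, inv_one]
  | succ n ih =>
    calc ∑ v with G.dist σ v = n + 1, (β v)⁻¹
      _ ≤ ∑ v with G.dist σ v = n + 1, ∑ u with G.dist σ u = n ∧ G.Adj u v,
            (β u * G.degree u)⁻¹ := by
          refine Finset.sum_le_sum fun v hv ↦ ?_
          obtain ⟨u, q, h, hu, hq, hqv⟩ :=
            hG.exists_isPath_concat_of_dist_eq_succ (Finset.mem_filter.1 hv).2
          rw [hβ v _ hqv, hqv.prod_support_concat_erase, ← hβ u q hq]
          exact Finset.single_le_sum (f := fun u ↦ (β u * G.degree u)⁻¹)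
            (fun w _ ↦ inv_nonneg.2 (mul_nonneg (hβ_nonneg w) (Nat.cast_nonneg _)))
            (by simp [hu, h])
      _ = ∑ u with G.dist σ u = n, ∑ v with G.dist σ v = n + 1 ∧ G.Adj u v,
            (β u * G.degree u)⁻¹ :=
          Finset.sum_comm' fun v u ↦ by simp; tauto
      _ ≤ ∑ u with G.dist σ u = n, (β u)⁻¹ := by
          refine Finset.sum_le_sum fun u _ ↦ ?_
          rw [Finset.sum_const, nsmul_eq_mul, mul_inv]
          have hcard : (({v | G.dist σ v = n + 1 ∧ G.Adj u v} : Finset V).card : ℝ) ≤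
              G.degree u := by
            rw [← G.card_neighborFinset_eq_degree]
            exact_mod_cast Finset.card_le_card fun v ↦ by simp
          calc _ ≤ (G.degree u : ℝ) * ((β u)⁻¹ * (G.degree u : ℝ)⁻¹) := by
                have := hβ_nonneg u
                gcongr
            _ = (β u)⁻¹ * ((G.degree u : ℝ) * (G.degree u : ℝ)⁻¹) := by ring
            _ ≤ (β u)⁻¹ :=
                mul_le_of_le_one_right (inv_nonneg.2 (hβ_nonneg u)) mul_inv_le_one
      _ ≤ 1 := ih

end SimpleGraph

/-- For a finite rooted tree with root `σ`, where `β v` is the product of degrees along the path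
from `σ` to `v` excluding `v`, and `d v` is the distance from the root:
for every `0 < c < 1`, `∑_v d(v)·c^{d(v)}/β(v) ≤ c/(1-c)²`. -/
theorem stmt_6
    {V : Type*} [Fintype V] [DecidableEq V]
    (G : SimpleGraph V) [DecidableRel G.Adj] (hG : G.IsTree) (σ : V)
    (β : V → ℝ)
    (hβ : ∀ (v : V) (p : G.Walk σ v), p.IsPath →
      β v = ∏ w ∈ p.support.toFinset.erase v, (G.degree w : ℝ))
    (c : ℝ) (hc0 : 0 < c) (hc1 : c < 1) :
    ∑ v : V, (G.dist σ v : ℝ) * c ^ (G.dist σ v) / β v ≤ c / (1 - c) ^ 2 := by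
  have hsum : HasSum (fun n : ℕ ↦ (n : ℝ) * c ^ n) (c / (1 - c) ^ 2) :=
    hasSum_coe_mul_geometric_of_norm_lt_one (by rwa [Real.norm_of_nonneg hc0.le])
  calc ∑ v : V, (G.dist σ v : ℝ) * c ^ (G.dist σ v) / β v
    _ = ∑ n ∈ Finset.univ.image (G.dist σ), ∑ v with G.dist σ v = n,
          (G.dist σ v : ℝ) * c ^ (G.dist σ v) / β v :=
        (Finset.sum_fiberwise_of_maps_to
          (fun v _ ↦ Finset.mem_image_of_mem _ (Finset.mem_univ v)) _).symm
    _ ≤ ∑ n ∈ Finset.univ.image (G.dist σ), (n : ℝ) * c ^ n := by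
        refine Finset.sum_le_sum fun n _ ↦ ?_
        calc ∑ v with G.dist σ v = n, (G.dist σ v : ℝ) * c ^ (G.dist σ v) / β v
          _ = (n * c ^ n) * ∑ v with G.dist σ v = n, (β v)⁻¹ := by
              rw [Finset.mul_sum]
              refine Finset.sum_congr rfl fun v hv ↦ ?_
              rw [(Finset.mem_filter.1 hv).2, div_eq_mul_inv]
          _ ≤ n * c ^ n :=
              mul_le_of_le_one_right (by positivity)
                (hG.connected.sum_inv_le_one_of_prod_degree hβ n)
    _ ≤ c / (1 - c) ^ 2 := sum_le_hasSum _ (fun n _ ↦ by positivity) hsum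
end

section
/- Let T be a finite tree (connected acyclic simple graph) with a designated root σ, and for each vertex v let β(v) be the product of the degrees Δ_w over all vertices w on the unique path from σ to v excluding v itself (so β(σ) = 1). Then the sum of 1/β(v) over all leaves v of T is at most 1. -/
/-- A sum of nonnegative terms over a union is at most the sum of the sums. -/
theorem Finset.sum_biUnion_le_of_nonneg {ι α : Type*} [DecidableEq α] (s : Finset ι)
    (t : ι → Finset α) {f : α → ℝ} (hf : ∀ a, 0 ≤ f a) :
    ∑ a ∈ s.biUnion t, f a ≤ ∑ i ∈ s, ∑ a ∈ t i, f a := by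
  classical
  induction s using Finset.induction_on with
  | empty => simp
  | insert i s hi ih =>
    rw [Finset.biUnion_insert, Finset.sum_insert hi]
    have h₁ := Finset.sum_union_inter (s₁ := t i) (s₂ := s.biUnion t) (f := f)
    have h₂ : 0 ≤ ∑ a ∈ t i ∩ s.biUnion t, f a := Finset.sum_nonneg fun a _ => hf a
    linarith

namespace SimpleGraph

variable {V : Type*} {G : SimpleGraph V}

/-- Every vertex other than the root has a neighbor one step closer to the root. -/
theorem Connected.exists_adj_dist_eq_add_one (hG : G.Connected) {σ v : V} (hv : v ≠ σ) :
    ∃ u, G.Adj u v ∧ G.dist σ v = G.dist σ u + 1 := by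
  obtain ⟨p, hp⟩ := hG.exists_walk_length_eq_dist v σ
  cases p with
  | nil => exact absurd rfl hv
  | @cons _ u _ h q =>
    refine ⟨u, h.symm, ?_⟩
    have h₁ : G.dist u σ ≤ q.length := dist_le q
    have h₂ : G.dist v σ ≤ G.dist v u + G.dist u σ := hG.dist_triangle
    rw [dist_eq_one_iff_adj.2 h] at h₂
    rw [Walk.length_cons] at hp
    rw [dist_comm (u := σ) (v := v), dist_comm (u := σ) (v := u)]
    omega

/-- A shortest path from the root extends to a path through any farther neighbor of its end. -/
theorem Connected.exists_isPath_concat (hG : G.Connected) {σ v c : V} (h : G.Adj v c)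
    (hd : G.dist σ c = G.dist σ v + 1) :
    ∃ p : G.Walk σ v, p.IsPath ∧ (p.concat h).IsPath ∧ c ∉ p.support := by
  classical
  obtain ⟨p, hp, hl⟩ := hG.exists_path_of_dist σ v
  have hc : c ∉ p.support := by
    intro hc
    have h₁ := dist_le (p.takeUntil c hc)
    have h₂ := p.length_takeUntil_le_length hc
    omega
  exact ⟨p, hp, hp.concat hc h, hc⟩

end SimpleGraph

/-- For a finite rooted tree with root `σ`, where `β v` is the product of degrees along the path
from `σ` to `v` excluding `v`: the sum of `1/β(v)` over all leaves `v` (vertices having no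
neighbor farther from the root) is at most `1`. -/
theorem stmt_7
    {V : Type*} [Fintype V] [DecidableEq V]
    (G : SimpleGraph V) [DecidableRel G.Adj] (hG : G.IsTree) (σ : V)
    (β : V → ℝ)
    (hβ : ∀ (v : V) (p : G.Walk σ v), p.IsPath →
      β v = ∏ w ∈ p.support.toFinset.erase v, (G.degree w : ℝ)) :
    ∑ v ∈ Finset.univ.filter
        (fun v => ∀ w, G.Adj v w → G.dist σ w ≠ G.dist σ v + 1),
      1 / β v ≤ 1 := by
  have hconn := hG.connected
  have hroot : β σ = 1 := by
    rw [hβ σ .nil .nil]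
    simp
  have hnonneg (v : V) : 0 ≤ 1 / β v := by
    obtain ⟨p, hp, -⟩ := hconn.exists_path_of_dist σ v
    rw [hβ v p hp]
    positivity
  have hchild {v c : V} (h : G.Adj v c) (hd : G.dist σ c = G.dist σ v + 1) :
      β c = G.degree v * β v := by
    obtain ⟨p, hp, hpc, hc⟩ := hconn.exists_isPath_concat h hd
    have hsupp : (p.concat h).support.toFinset.erase c = p.support.toFinset := by
      ext w
      simp only [SimpleGraph.Walk.support_concat, Finset.mem_erase, List.mem_toFinset,
        List.mem_append, List.mem_singleton]
      grind
    rw [hβ c _ hpc, hsupp, hβ v p hp, Finset.mul_prod_erase _ (fun w => (G.degree w : ℝ))]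
    simp
  let children (v : V) : Finset V := {c | G.Adj v c ∧ G.dist σ c = G.dist σ v + 1}
  have hsum (v : V) : ∑ c ∈ children v, 1 / β c ≤ 1 / β v := by
    have hconst : ∑ c ∈ children v, 1 / β c
        = ((children v).card / G.degree v : ℝ) * (1 / β v) := by
      rw [Finset.sum_congr rfl (g := fun _ => 1 / (G.degree v * β v))]
      · rw [Finset.sum_const, nsmul_eq_mul, div_mul_div_comm, mul_one, mul_one_div]
      · intro c hc
        have hc' : G.Adj v c ∧ G.dist σ c = G.dist σ v + 1 := by simpa [children] using hc
        rw [hchild hc'.1 hc'.2]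
    have hcard : (children v).card ≤ G.degree v := by
      rw [← G.card_neighborFinset_eq_degree]
      refine Finset.card_le_card fun c hc => ?_
      simp only [children, Finset.mem_filter] at hc
      simpa using hc.2.1
    rw [hconst]
    exact mul_le_of_le_one_left (hnonneg v)
      (div_le_one_of_le₀ (by exact_mod_cast hcard) (by positivity))
  set leaves := Finset.univ.filter (fun v => ∀ w, G.Adj v w → G.dist σ w ≠ G.dist σ v + 1)
  have hcover : ∑ v ∈ Finset.univ.erase σ, 1 / β v ≤ ∑ v ∈ leavesᶜ, 1 / β v := calc
    _ ≤ ∑ v ∈ leavesᶜ.biUnion children, 1 / β v := by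
      refine Finset.sum_le_sum_of_subset_of_nonneg (fun v hv => ?_) fun v _ _ => hnonneg v
      obtain ⟨u, hu, hd⟩ := hconn.exists_adj_dist_eq_add_one (Finset.ne_of_mem_erase hv)
      simp only [Finset.mem_biUnion, Finset.mem_compl, leaves, children, Finset.mem_filter,
        Finset.mem_univ, true_and]
      exact ⟨u, fun hleaf => hleaf v hu hd, hu, hd⟩
    _ ≤ ∑ v ∈ leavesᶜ, ∑ c ∈ children v, 1 / β c :=
      Finset.sum_biUnion_le_of_nonneg _ _ hnonneg
    _ ≤ ∑ v ∈ leavesᶜ, 1 / β v := Finset.sum_le_sum fun v _ => hsum v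
  have h₁ := Finset.add_sum_erase Finset.univ (fun v => 1 / β v) (Finset.mem_univ σ)
  have h₂ := Finset.sum_add_sum_compl leaves (fun v => 1 / β v)
  simp only [hroot, div_one] at h₁
  linarith
end

section
/- Let Δ ≥ 2 be a real number, let λ ∈ [0.7, 0.8], and let q ∈ [0,1] with p = 1 − q and qΔ < 0.1. Then p·(1/(λ + (1−λ)/Δ) − 1) + q·(Δ/(1−λ) − 1) ≤ 1/λ − 1 + qΔ/(1−λ) < 0.93. -/
/-- Expected number of failed excursion attempts in probabilistic following:
if `λ ∈ [0.7, 0.8]` and `qΔ < 0.1` then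
`p(1/(λ+(1-λ)/Δ) - 1) + q(Δ/(1-λ) - 1) ≤ 1/λ - 1 + qΔ/(1-λ) < 0.93`. -/
theorem stmt_12
    (Δ : ℝ) (hΔ : 2 ≤ Δ) (lam : ℝ) (hlam0 : 0.7 ≤ lam) (hlam1 : lam ≤ 0.8)
    (q : ℝ) (hq0 : 0 ≤ q) (hq1 : q ≤ 1) (hqΔ : q * Δ < 0.1) :
    (1 - q) * (1 / (lam + (1 - lam) / Δ) - 1) + q * (Δ / (1 - lam) - 1)
        ≤ 1 / lam - 1 + q * Δ / (1 - lam)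
    ∧ 1 / lam - 1 + q * Δ / (1 - lam) < 0.93 := by
  have hlam : 0 < lam := by linarith
  have hlam' : 0 < 1 - lam := by linarith
  constructor
  · have hle : 1 / (lam + (1 - lam) / Δ) ≤ 1 / lam := by
      apply one_div_le_one_div_of_le hlam
      have : 0 ≤ (1 - lam) / Δ := by positivity
      linarith
    have hone : 1 ≤ 1 / lam := by
      rw [le_div_iff₀ hlam]
      linarith
    have hcorrect := mul_le_mul_of_nonneg_left hle (sub_nonneg.2 hq1)
    have hfaulty : q * (Δ / (1 - lam)) = q * Δ / (1 - lam) := by ring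
    nlinarith [mul_le_mul_of_nonneg_left hone hq0]
  · have hinv : 1 / lam ≤ 10 / 7 := by
      rw [div_le_div_iff₀ hlam (by norm_num)]
      linarith
    have hfaulty : q * Δ / (1 - lam) < 1 / 2 := by
      rw [div_lt_div_iff₀ hlam' (by norm_num)]
      linarith
    linarith
end
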